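/- arXiv:1901.10714 — 5 statements merged into one kernel-verified Lean document; each statement's English description precedes it below -/
import Mathlib

section
/- Let n ≥ 2 and let F : {z ∈ ℂ : |z| ≤ 1} → M_n(ℂ) be a matrix function all of whose entries belong to the disk algebra A(𝔻), with det F(z) = 1 for all z in the closed unit disk. Then F is null-homotopic: there exists a continuous map H : [0,1] × {z ∈ ℂ : |z| ≤ 1} → M_n(ℂ) such that for each t ∈ [0,1] all entries of H(t,·) belong to A(𝔻), det H(t,z) = 1 for all t and z, H(0,z) = I for all z, and H(1,z) = F(z) for all z. -/
/-- Membership in the disk algebra `A(𝔻)`: continuous on the closed unit disk and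
holomorphic on the open unit disk. -/
def InDiskAlgebra (f : ℂ → ℂ) : Prop :=
  ContinuousOn f (Metric.closedBall 0 1) ∧ DifferentiableOn ℂ f (Metric.ball 0 1)

/-- The line `w ↦ 1 + w • M` of complex matrices leaves the invertible matrices at
only finitely many complex parameters. -/
theorem Matrix.finite_setOf_det_one_add_smul_eq_zero {m : Type*} [Fintype m] [DecidableEq m]
    (M : Matrix m m ℂ) : {w : ℂ | (1 + w • M).det = 0}.Finite := by
  set P : Polynomial ℂ := (1 + (Polynomial.X : Polynomial ℂ) • M.map Polynomial.C).det with hP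
  have heval (w : ℂ) : P.eval w = (1 + w • M).det := by
    rw [hP, ← Polynomial.coe_evalRingHom, RingHom.map_det]
    congr 1
    ext i j
    by_cases hij : i = j <;> simp [hij, mul_comm w]
  have hP0 : P ≠ 0 := by
    intro h
    simpa [h] using heval 0
  refine (Polynomial.finite_setOfPred_isRoot hP0).subset fun w hw => ?_
  rw [Set.mem_ofPred_eq, Polynomial.IsRoot, heval]
  exact hw

/-- The complex special linear group is path connected: every matrix of determinant one is joined
to the identity. -/
theorem Matrix.exists_continuous_det_eq_one {m : Type*} [Fintype m] [DecidableEq m] [Nonempty m]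
    (A : Matrix m m ℂ) (hA : A.det = 1) :
    ∃ γ : ℝ → Matrix m m ℂ, Continuous γ ∧ (∀ t, (γ t).det = 1) ∧ γ 0 = 1 ∧ γ 1 = A := by
  obtain ⟨p, hp⟩ := (finite_setOf_det_one_add_smul_eq_zero (A - 1)).countable
    |>.isPathConnected_compl_of_one_lt_rank (E := ℂ) (by simp [Complex.rank_real_complex])
    |>.joinedIn 0 (by simp) 1 (by simp [hA])
  set B : ℝ → Matrix m m ℂ := fun t => 1 + p.extend t • (A - 1) with hB
  have hBcont : Continuous B := by
    have := p.continuous_extend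
    fun_prop
  have hBdet (t : ℝ) : (B t).det ≠ 0 := hp _
  have hB0 : B 0 = 1 := by simp [hB]
  have hB1 : B 1 = A := by simp [hB]
  obtain ⟨i⟩ := ‹Nonempty m›
  refine ⟨fun t => diagonal (Function.update 1 i (B t).det⁻¹) * B t, ?_, fun t => ?_, ?_, ?_⟩
  · have hinv : Continuous fun t => (B t).det⁻¹ := hBcont.matrix_det.inv₀ hBdet
    exact ((continuous_const.update i hinv).matrix_diagonal).matrix_mul hBcont
  · rw [det_mul, det_diagonal, Finset.prod_update_of_mem (Finset.mem_univ i)]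
    simp [hBdet t]
  · simp [hB0]
  · simp [hB1, hA]

theorem norm_ofReal_mul_le {t : ℝ} (ht : t ∈ Set.Icc (0 : ℝ) 1) (z : ℂ) : ‖(t : ℂ) * z‖ ≤ ‖z‖ := by
  rw [norm_mul, Complex.norm_real, Real.norm_of_nonneg ht.1]
  exact mul_le_of_le_one_left (norm_nonneg z) ht.2

theorem ofReal_mul_mem_closedBall {t : ℝ} (ht : t ∈ Set.Icc (0 : ℝ) 1) {z : ℂ}
    (hz : z ∈ Metric.closedBall (0 : ℂ) 1) : (t : ℂ) * z ∈ Metric.closedBall (0 : ℂ) 1 := by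
  rw [mem_closedBall_zero_iff] at hz ⊢
  exact (norm_ofReal_mul_le ht z).trans hz

theorem InDiskAlgebra.comp_ofReal_mul {f : ℂ → ℂ} (hf : InDiskAlgebra f) {t : ℝ}
    (ht : t ∈ Set.Icc (0 : ℝ) 1) : InDiskAlgebra fun z => f (t * z) := by
  refine ⟨hf.1.comp (by fun_prop) fun z hz => ofReal_mul_mem_closedBall ht hz,
    hf.2.comp (by fun_prop) fun z hz => ?_⟩
  rw [mem_ball_zero_iff] at hz ⊢
  exact (norm_ofReal_mul_le ht z).trans_lt hz

theorem InDiskAlgebra.sum_mul_const {ι : Type*} (s : Finset ι) {f : ι → ℂ → ℂ}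
    (hf : ∀ k ∈ s, InDiskAlgebra (f k)) (c : ι → ℂ) :
    InDiskAlgebra fun z => ∑ k ∈ s, f k z * c k :=
  ⟨continuousOn_finsetSum s fun k hk => (hf k hk).1.mul continuousOn_const,
    DifferentiableOn.fun_sum fun k hk => (hf k hk).2.mul_const (c k)⟩

/-- any matrix in `SL_n(A(𝔻))` (`n ≥ 2`) is null-homotopic within
`SL_n(A(𝔻))`. -/
theorem stmt2 (n : ℕ) (hn : 2 ≤ n) (F : ℂ → Matrix (Fin n) (Fin n) ℂ)
    (hF : ∀ i j, InDiskAlgebra fun z => F z i j)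
    (hdet : ∀ z ∈ Metric.closedBall (0 : ℂ) 1, (F z).det = 1) :
    ∃ H : ℝ × ℂ → Matrix (Fin n) (Fin n) ℂ,
      ContinuousOn H (Set.Icc (0 : ℝ) 1 ×ˢ Metric.closedBall (0 : ℂ) 1) ∧
      (∀ t ∈ Set.Icc (0 : ℝ) 1, ∀ i j, InDiskAlgebra fun z => H (t, z) i j) ∧
      (∀ t ∈ Set.Icc (0 : ℝ) 1, ∀ z ∈ Metric.closedBall (0 : ℂ) 1, (H (t, z)).det = 1) ∧
      (∀ z ∈ Metric.closedBall (0 : ℂ) 1, H (0, z) = 1) ∧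
      (∀ z ∈ Metric.closedBall (0 : ℂ) 1, H (1, z) = F z) := by
  have hzero : (0 : ℂ) ∈ Metric.closedBall (0 : ℂ) 1 := by simp
  have hF0 : IsUnit (F 0).det := by simp [hdet 0 hzero]
  have : Nonempty (Fin n) := ⟨⟨0, by omega⟩⟩
  obtain ⟨γ, hγ, hγdet, hγ0, hγ1⟩ := (F 0).exists_continuous_det_eq_one (hdet 0 hzero)
  have hFcont : ContinuousOn F (Metric.closedBall 0 1) :=
    continuousOn_pi.2 fun i => continuousOn_pi.2 fun j => (hF i j).1
  refine ⟨fun q => F (q.1 * q.2) * ((F 0)⁻¹ * γ q.1), ?_, fun t ht i j => ?_, fun t ht z hz => ?_,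
    fun z _ => ?_, fun z _ => ?_⟩
  · have hscale : ContinuousOn (fun q : ℝ × ℂ => F (q.1 * q.2))
        (Set.Icc (0 : ℝ) 1 ×ˢ Metric.closedBall (0 : ℂ) 1) :=
      hFcont.comp (by fun_prop) fun q hq => ofReal_mul_mem_closedBall hq.1 hq.2
    have hγ' : Continuous fun q : ℝ × ℂ => (F 0)⁻¹ * γ q.1 :=
      continuous_const.matrix_mul (hγ.comp continuous_fst)
    exact hscale.mul hγ'.continuousOn
  · simp only [Matrix.mul_apply (M := F _)]
    exact .sum_mul_const _ (fun k _ => (hF i k).comp_ofReal_mul ht) _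
  · simp [Matrix.det_mul, Matrix.det_nonsing_inv, hdet _ (ofReal_mul_mem_closedBall ht hz),
      hdet 0 hzero, hγdet]
  · simp [hγ0, Matrix.mul_nonsing_inv _ hF0]
  · simp [hγ1, Matrix.nonsing_inv_mul _ hF0]
end

section
/- Let R be a commutative unital ring with Bass stable rank one. Then every matrix X ∈ M_2(R) with det X = 1 is a product of 4 unipotent triangular matrices: X = L_1 · U_1 · L_2 · U_2 where L_1, L_2 are lower triangular with 1's on the diagonal and U_1, U_2 are upper triangular with 1's on the diagonal, all with entries in R. -/
/-- A commutative unital ring has Bass stable rank one: whenever `x₁, x₂` generate the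
unit ideal, there exists `y` such that `x₁ + y * x₂` is a unit. -/
def BassStableRankOne (R : Type*) [CommRing R] : Prop :=
  ∀ x₁ x₂ : R, (∃ a b : R, x₁ * a + x₂ * b = 1) → ∃ y : R, IsUnit (x₁ + y * x₂)

/-- A unipotent upper triangular matrix: 1's on the diagonal, zeros below. -/
def UnipotentUpper {n : ℕ} {R : Type*} [CommRing R] (M : Matrix (Fin n) (Fin n) R) : Prop :=
  (∀ i, M i i = 1) ∧ ∀ i j : Fin n, j < i → M i j = 0

/-- A unipotent lower triangular matrix: 1's on the diagonal, zeros above. -/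
def UnipotentLower {n : ℕ} {R : Type*} [CommRing R] (M : Matrix (Fin n) (Fin n) R) : Prop :=
  (∀ i, M i i = 1) ∧ ∀ i j : Fin n, i < j → M i j = 0

theorem unipotentUpper_fin_two {R : Type*} [CommRing R] (u : R) :
    UnipotentUpper !![1, u; 0, 1] := by
  simp [UnipotentUpper, Fin.forall_fin_two]

theorem unipotentLower_fin_two {R : Type*} [CommRing R] (u : R) :
    UnipotentLower !![1, 0; u, 1] := by
  simp [UnipotentLower, Fin.forall_fin_two]

/-- over a commutative unital ring of Bass stable rank one, every matrix in
`SL_2(R)` is a product `L₁ · U₁ · L₂ · U₂` of 4 unipotent triangular matrices. -/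
theorem stmt3 (R : Type*) [CommRing R] (hR : BassStableRankOne R)
    (X : Matrix (Fin 2) (Fin 2) R) (hX : X.det = 1) :
    ∃ L₁ U₁ L₂ U₂ : Matrix (Fin 2) (Fin 2) R,
      UnipotentLower L₁ ∧ UnipotentUpper U₁ ∧ UnipotentLower L₂ ∧ UnipotentUpper U₂ ∧
      X = L₁ * U₁ * L₂ * U₂ := by
  obtain ⟨a, b, c, d, rfl⟩ : ∃ a b c d, X = !![a, b; c, d] :=
    ⟨_, _, _, _, X.eta_fin_two⟩
  rw [Matrix.det_fin_two_of] at hX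
  obtain ⟨s, hs⟩ := hR c a ⟨-b, d, by linear_combination hX⟩
  obtain ⟨w, hw⟩ := hs.exists_right_inv
  obtain ⟨t, ht⟩ : ∃ t, t * (c + s * a) = 1 - d - s * b :=
    ⟨(1 - d - s * b) * w, by linear_combination (1 - d - s * b) * hw⟩
  -- Row and column operations turn `X` into a matrix of determinant one with lower right entry `1`.
  refine ⟨!![1, 0; -s, 1], !![1, b + t * a; 0, 1], !![1, 0; c + s * a, 1], !![1, -t; 0, 1],
    unipotentLower_fin_two _, unipotentUpper_fin_two _, unipotentLower_fin_two _,
    unipotentUpper_fin_two _, ?_⟩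
  have h₁₁ : a = 1 + (b + t * a) * (c + s * a) := by linear_combination hX - a * ht
  ext i j
  fin_cases i <;> fin_cases j <;> simp [Matrix.mul_apply, Fin.sum_univ_two]
  · linear_combination h₁₁
  · linear_combination -t * h₁₁
  · linear_combination -s * h₁₁
  · linear_combination s * t * h₁₁ + ht
end

section
/- Let A be a commutative unital complex Banach algebra with Bass stable rank one, and let n ≥ 2. Then every matrix X ∈ M_n(A) with det X = 1 is null-homotopic: there exists a continuous map H : [0,1] → M_n(A) with det H(t) = 1 for all t, H(0) = I and H(1) = X. -/
namespace Matrix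

section RowReduction

variable {R : Type*} [CommRing R] {m : Type*} [Fintype m] [DecidableEq m]

theorem det_one_add_vecMulVec_eq_one {b c : m → R} (h : c ⬝ᵥ b = 0) :
    (1 + vecMulVec b c).det = 1 := by
  rw [vecMulVec_eq Unit, det_one_add_replicateCol_mul_replicateRow, h, add_zero]

theorem one_add_vecMulVec_mul_apply (b c : m → R) (M : Matrix m m R) (i j : m) :
    ((1 + vecMulVec b c) * M) i j = M i j + b i * ∑ k, c k * M k j := by
  rw [add_mul, one_mul, add_apply]
  simp [mul_apply, vecMulVec_apply, Finset.mul_sum, mul_assoc]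

theorem mul_one_add_vecMulVec_apply (b c : m → R) (M : Matrix m m R) (i j : m) :
    (M * (1 + vecMulVec b c)) i j = M i j + (∑ k, M i k * b k) * c j := by
  rw [mul_add, mul_one, add_apply]
  simp [mul_apply, vecMulVec_apply, Finset.sum_mul, mul_assoc]

/-- The block diagonal matrix with blocks `1` and `M`. -/
def oneBlock {n : ℕ} (M : Matrix (Fin n) (Fin n) R) : Matrix (Fin (n + 1)) (Fin (n + 1)) R :=
  of (Fin.cons (Fin.cons 1 0) fun i => Fin.cons 0 (M i))

theorem det_oneBlock {n : ℕ} (M : Matrix (Fin n) (Fin n) R) : (oneBlock M).det = M.det := by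
  rw [det_succ_column_zero, Fin.sum_univ_succ]
  have h : (oneBlock M).submatrix Fin.succ Fin.succ = M := by
    ext i j
    simp [oneBlock]
  simp [h]
  simp [oneBlock]

theorem oneBlock_one (n : ℕ) : oneBlock (1 : Matrix (Fin n) (Fin n) R) = 1 := by
  ext i j
  cases i using Fin.cases <;> cases j using Fin.cases <;>
    simp [oneBlock, one_apply, Fin.succ_ne_zero, (Fin.succ_ne_zero _).symm]

theorem oneBlock_submatrix_succ {n : ℕ} {M : Matrix (Fin (n + 1)) (Fin (n + 1)) R}
    (h : M 0 0 = 1) (hcol : ∀ i, i ≠ 0 → M i 0 = 0) (hrow : ∀ j, j ≠ 0 → M 0 j = 0) :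
    oneBlock (M.submatrix Fin.succ Fin.succ) = M := by
  ext i j
  cases i using Fin.cases <;> cases j using Fin.cases <;>
    simp [oneBlock, h, hcol, hrow, Fin.succ_ne_zero]

end RowReduction

section Homotopy

variable {R : Type*} [CommRing R] [TopologicalSpace R]

theorem continuous_oneBlock {n : ℕ} :
    Continuous (oneBlock : Matrix (Fin n) (Fin n) R → _) := by
  refine continuous_matrix fun i j => ?_
  cases i using Fin.cases <;> cases j using Fin.cases <;>
    simp only [oneBlock, of_apply, Fin.cons_zero, Fin.cons_succ] <;> fun_prop

variable [IsTopologicalRing R] [Algebra ℝ R] [ContinuousSMul ℝ R]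

section

variable {m : Type*} [Fintype m] [DecidableEq m]

theorem joinedIn_one_add_vecMulVec {b c : m → R} (h : c ⬝ᵥ b = 0) :
    JoinedIn {M : Matrix m m R | M.det = 1} 1 (1 + vecMulVec b c) := by
  refine JoinedIn.ofLine (f := fun t : ℝ => 1 + vecMulVec (t • b) c) ?_ (by simp) (by simp) ?_
  · refine Continuous.continuousOn (continuous_matrix fun i j => ?_)
    simp only [add_apply, vecMulVec_apply, Pi.smul_apply]
    fun_prop
  · rintro _ ⟨t, -, rfl⟩
    exact det_one_add_vecMulVec_eq_one (by rw [dotProduct_smul, h, smul_zero])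

theorem joinedIn_one_add_vecMulVec_mul {b c : m → R} (h : c ⬝ᵥ b = 0) {M : Matrix m m R}
    (hM : M.det = 1) :
    JoinedIn {M : Matrix m m R | M.det = 1} M ((1 + vecMulVec b c) * M) := by
  obtain ⟨γ, hγ⟩ := joinedIn_one_add_vecMulVec h
  refine ⟨(γ.map (f := (· * M)) (by fun_prop)).cast (by simp) rfl, fun t => ?_⟩
  have := hγ t
  simp_all

theorem joinedIn_mul_one_add_vecMulVec {b c : m → R} (h : c ⬝ᵥ b = 0) {M : Matrix m m R}
    (hM : M.det = 1) :
    JoinedIn {M : Matrix m m R | M.det = 1} M (M * (1 + vecMulVec b c)) := by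
  obtain ⟨γ, hγ⟩ := joinedIn_one_add_vecMulVec h
  refine ⟨(γ.map (f := (M * ·)) (by fun_prop)).cast (by simp) rfl, fun t => ?_⟩
  have := hγ t
  simp_all

end

theorem exists_joinedIn_isUnit_apply_zero (hR : BassStableRankOne R) {n : ℕ}
    {M : Matrix (Fin (n + 1)) (Fin (n + 1)) R} (hM : M.det = 1) :
    ∃ N : Matrix (Fin (n + 1)) (Fin (n + 1)) R,
      JoinedIn {M : Matrix (Fin (n + 1)) (Fin (n + 1)) R | M.det = 1} M N ∧ IsUnit (N 0 0) := by
  have h : (M.adjugate * M) 0 0 = 1 := by simp [adjugate_mul, hM]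
  rw [mul_apply, Fin.sum_univ_succ] at h
  obtain ⟨y, hy⟩ := hR (M 0 0) (∑ k : Fin n, M.adjugate 0 k.succ * M k.succ 0)
    ⟨M.adjugate 0 0, 1, by linear_combination h⟩
  refine ⟨_, joinedIn_one_add_vecMulVec_mul (b := Pi.single 0 1)
    (c := Fin.cons 0 fun k => y * M.adjugate 0 k.succ) (by simp) hM, ?_⟩
  rw [one_add_vecMulVec_mul_apply, Fin.sum_univ_succ]
  simpa [Finset.mul_sum, mul_assoc] using hy

theorem exists_joinedIn_apply_zero_eq_one {n : ℕ}
    {M : Matrix (Fin (n + 2)) (Fin (n + 2)) R} (hM : M.det = 1) (hu : IsUnit (M 0 0)) :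
    ∃ N : Matrix (Fin (n + 2)) (Fin (n + 2)) R,
      JoinedIn {M : Matrix (Fin (n + 2)) (Fin (n + 2)) R | M.det = 1} M N ∧ N 0 0 = 1 := by
  obtain ⟨v, hv⟩ := hu.exists_left_inv
  have h₁ := joinedIn_one_add_vecMulVec_mul (b := Pi.single 1 1)
    (c := Pi.single 0 ((1 - M 1 0) * v)) (by simp) hM
  have h₂ := joinedIn_one_add_vecMulVec_mul (b := Pi.single 0 1)
    (c := Pi.single 1 (1 - M 0 0)) (by simp) h₁.target_mem
  refine ⟨_, h₁.trans h₂, ?_⟩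
  simp [one_add_vecMulVec_mul_apply, Pi.single_apply, mul_assoc, hv]

theorem exists_joinedIn_oneBlock {n : ℕ}
    {M : Matrix (Fin (n + 1)) (Fin (n + 1)) R} (hM : M.det = 1) (h : M 0 0 = 1) :
    ∃ N : Matrix (Fin n) (Fin n) R,
      JoinedIn {M : Matrix (Fin (n + 1)) (Fin (n + 1)) R | M.det = 1} M (oneBlock N) := by
  have h₁ := joinedIn_one_add_vecMulVec_mul (b := Fin.cons 0 fun i => -M i.succ 0)
    (c := Pi.single 0 1) (by simp) hM
  have h₂ := joinedIn_mul_one_add_vecMulVec (b := Pi.single 0 1)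
    (c := Fin.cons 0 fun j => -M 0 j.succ) (by simp) h₁.target_mem
  have h₃ := h₁.trans h₂
  rw [← oneBlock_submatrix_succ (M := _ * _ * _) ?_ ?_ ?_] at h₃
  · exact ⟨_, h₃⟩
  · simp [mul_one_add_vecMulVec_apply, one_add_vecMulVec_mul_apply, Pi.single_apply, h]
  · intro i hi
    obtain ⟨i, rfl⟩ := Fin.exists_succ_eq.2 hi
    simp [mul_one_add_vecMulVec_apply, one_add_vecMulVec_mul_apply, Pi.single_apply, h]
  · intro j hj
    obtain ⟨j, rfl⟩ := Fin.exists_succ_eq.2 hj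
    simp [mul_one_add_vecMulVec_apply, one_add_vecMulVec_mul_apply, Pi.single_apply, h]

theorem joinedIn_one_of_bassStableRankOne (hR : BassStableRankOne R) :
    ∀ {n : ℕ} {M : Matrix (Fin n) (Fin n) R}, M.det = 1 →
      JoinedIn {M : Matrix (Fin n) (Fin n) R | M.det = 1} 1 M
  | 0, M, hM => by
    rw [Subsingleton.elim M 1]
    exact JoinedIn.refl det_one
  | 1, M, hM => by
    have h : M = 1 := by
      ext i j
      rw [Subsingleton.elim i 0, Subsingleton.elim j 0, one_apply_eq, ← hM, det_fin_one]
    rw [h]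
    exact JoinedIn.refl det_one
  | n + 2, M, hM => by
    obtain ⟨M₁, h₁, hu⟩ := exists_joinedIn_isUnit_apply_zero hR hM
    obtain ⟨M₂, h₂, hone⟩ := exists_joinedIn_apply_zero_eq_one h₁.target_mem hu
    obtain ⟨N, h₃⟩ := exists_joinedIn_oneBlock h₂.target_mem hone
    have hN : N.det = 1 := by
      rw [← det_oneBlock]
      exact h₃.target_mem
    obtain ⟨γ, hγ⟩ := joinedIn_one_of_bassStableRankOne hR hN
    have h₄ : JoinedIn {M : Matrix (Fin (n + 2)) (Fin (n + 2)) R | M.det = 1} 1 (oneBlock N) :=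
      ⟨(γ.map continuous_oneBlock).cast (oneBlock_one _).symm rfl,
        fun t => (det_oneBlock _).trans (hγ t)⟩
    exact h₄.trans ((h₁.trans h₂).trans h₃).symm

end Homotopy

end Matrix

/-- over a commutative unital complex Banach algebra of Bass stable rank
one, every matrix in `SL_n(A)` (`n ≥ 2`) is null-homotopic. -/
theorem stmt5 (A : Type*) [NormedCommRing A] [NormedAlgebra ℂ A] [CompleteSpace A]
    (hA : BassStableRankOne A)
    (n : ℕ) (hn : 2 ≤ n) (X : Matrix (Fin n) (Fin n) A) (hX : X.det = 1) :
    ∃ H : ℝ → Matrix (Fin n) (Fin n) A,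
      ContinuousOn H (Set.Icc 0 1) ∧
      (∀ t ∈ Set.Icc (0 : ℝ) 1, (H t).det = 1) ∧
      H 0 = 1 ∧ H 1 = X := by
  let _ : NormedAlgebra ℝ A := NormedAlgebra.restrictScalars ℝ ℂ A
  obtain ⟨γ, hγ⟩ := Matrix.joinedIn_one_of_bassStableRankOne hA hX
  refine ⟨γ.extend, γ.continuous_extend.continuousOn, fun t ht => ?_, by simp, by simp⟩
  rw [γ.extend_apply ht]
  exact hγ ⟨t, ht⟩
end

section
/- Let S ⊆ ℂ be a closed discrete subset, and for each w ∈ S let N_w ∈ ℕ and let J_w be a polynomial of degree at most N_w with J_w(w) ≠ 0. Then there exist entire functions f, g : ℂ → ℂ with f = exp ∘ g (in particular f never vanishes) such that for every w ∈ S the function f − J_w vanishes at w to order greater than N_w, i.e. f(z) − J_w(z) = o(|z − w|^{N_w}) as z → w. -/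
open Filter Topology Asymptotics

open Polynomial in
/-- A polynomial multiplied by a suitable polynomial congruent to `1` modulo `(X - w) ^ d` becomes
arbitrarily small on the disc of radius `‖w‖ / 2`. -/
lemma exists_small_multiple (p : ℂ[X]) (w : ℂ) (d : ℕ) {ε : ℝ} (hε : 0 < ε) :
    ∃ q : ℂ[X], p ∣ q ∧ (X - C w) ^ d ∣ q - p ∧
      ∀ z : ℂ, ‖z‖ < ‖w‖ / 2 → ‖q.eval z‖ ≤ ε := by
  rcases eq_or_ne w 0 with rfl | hw
  · refine ⟨p, dvd_rfl, by simp, fun z hz => ?_⟩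
    have := norm_nonneg z
    simp only [norm_zero, zero_div] at hz
    linarith
  obtain ⟨B, hB⟩ : ∃ B, ∀ z ∈ Metric.closedBall (0 : ℂ) (‖w‖ / 2), ‖p.eval z‖ ≤ B :=
    (isCompact_closedBall _ _).exists_bound_of_continuousOn p.continuous.continuousOn
  have hB0 : 0 ≤ B := (norm_nonneg _).trans (hB 0 (by simp; positivity))
  have hcont : ContinuousAt (fun t : ℂ => 1 - (1 - t) ^ d) 0 := by fun_prop
  obtain ⟨δ, hδ, h⟩ := Metric.continuousAt_iff.1 hcont (ε / (B + 1)) (by positivity)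
  obtain ⟨m, hm⟩ := exists_pow_lt_of_lt_one hδ (by norm_num : (1 / 2 : ℝ) < 1)
  refine ⟨p * (1 - (1 - (C w⁻¹ * X) ^ m) ^ d), dvd_mul_right _ _, ?_, fun z hz => ?_⟩
  · have hdvd : X - C w ∣ 1 - (C w⁻¹ * X) ^ m := by
      rw [dvd_iff_isRoot]
      simp [hw]
    have : p * (1 - (1 - (C w⁻¹ * X) ^ m) ^ d) - p = (1 - (C w⁻¹ * X) ^ m) ^ d * (-p) := by ring
    rw [this]
    exact (pow_dvd_pow_of_dvd hdvd d).mul_right _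
  · have hw' : 0 < ‖w‖ := norm_pos_iff.2 hw
    have hz' : ‖(w⁻¹ * z) ^ m‖ < δ := by
      refine lt_of_le_of_lt ?_ hm
      rw [norm_pow, norm_mul, norm_inv]
      gcongr
      rw [inv_mul_le_iff₀ hw']
      linarith
    have h1 := h (x := (w⁻¹ * z) ^ m) (by simpa using hz')
    simp only [sub_zero, one_pow, sub_self, dist_zero_right] at h1
    have h2 := hB z (by simpa using hz.le)
    simp only [eval_mul, eval_sub, eval_one, eval_pow, eval_C, eval_X, norm_mul]
    calc _ ≤ B * (ε / (B + 1)) := by gcongr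
      _ ≤ (B + 1) * (ε / (B + 1)) := by gcongr; linarith
      _ = ε := by field_simp

open Polynomial in
/-- A correction polynomial, small on the disc of radius `‖w‖ / 2`, which prescribes the jet at `w`
without affecting the jets at finitely many other points. -/
lemma exists_small_correction (A : Finset ℂ) (d : ℂ → ℕ) (w : ℂ) (hw : w ∉ A) (T : ℂ[X])
    {ε : ℝ} (hε : 0 < ε) :
    ∃ q : ℂ[X], (∀ a ∈ A, (X - C a) ^ d a ∣ q) ∧ (X - C w) ^ d w ∣ q - T ∧
      ∀ z : ℂ, ‖z‖ < ‖w‖ / 2 → ‖q.eval z‖ ≤ ε := by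
  have hcop : IsCoprime (∏ a ∈ A, (X - C a) ^ d a) ((X - C w) ^ d w) := by
    refine IsCoprime.prod_left fun a ha => IsCoprime.pow ?_
    exact isCoprime_X_sub_C_of_isUnit_sub
      (sub_ne_zero.2 (ne_of_mem_of_not_mem ha hw)).isUnit
  obtain ⟨a, b, hab⟩ := hcop
  obtain ⟨q, hq1, hq2, hq3⟩ :=
    exists_small_multiple (T * (a * ∏ a ∈ A, (X - C a) ^ d a)) w (d w) hε
  refine ⟨q, fun c hc => ?_, ?_, hq3⟩
  · refine ((Finset.dvd_prod_of_mem (fun a => (X - C a) ^ d a) hc).trans ?_).trans hq1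
    exact (dvd_mul_left _ _).mul_left _
  · have : q - T = (q - T * (a * ∏ a ∈ A, (X - C a) ^ d a)) - (X - C w) ^ d w * (T * b) := by
      linear_combination T * hab
    rw [this]
    exact dvd_sub hq2 (dvd_mul_right _ _)

open Polynomial in
/-- If a polynomial divisible by `(X - w) ^ d` is bounded by `M` on the unit circle about `w`, then
it is bounded by `M ‖z - w‖ ^ d` on the unit disc about `w`. -/
lemma norm_eval_le_mul_pow_of_dvd {p : ℂ[X]} {w : ℂ} {d : ℕ} (hp : (X - C w) ^ d ∣ p) {M : ℝ}
    (hM : ∀ z : ℂ, ‖z - w‖ = 1 → ‖p.eval z‖ ≤ M) {z : ℂ} (hz : ‖z - w‖ ≤ 1) :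
    ‖p.eval z‖ ≤ M * ‖z - w‖ ^ d := by
  obtain ⟨r, rfl⟩ := hp
  have hr : ‖r.eval z‖ ≤ M := by
    refine Complex.norm_le_of_forall_mem_frontier_norm_le (U := Metric.ball w 1)
      Metric.isBounded_ball (f := fun z => r.eval z) r.differentiable.diffContOnCl ?_ ?_
    · intro y hy
      rw [frontier_ball _ one_ne_zero, mem_sphere_iff_norm] at hy
      simpa [hy] using hM y hy
    · rw [closure_ball _ one_ne_zero, mem_closedBall_iff_norm]
      exact hz
  simp only [eval_mul, eval_pow, eval_sub, eval_X, eval_C, norm_mul, norm_pow]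
  rw [mul_comm]
  gcongr

lemma finite_inter_closedBall_of_not_accPt {S : Set ℂ}
    (hS : ∀ z : ℂ, ¬ AccPt z (Filter.principal S)) (R : ℝ) :
    (S ∩ Metric.closedBall 0 R).Finite := by
  by_contra h
  obtain ⟨z, -, hz⟩ := Set.Infinite.exists_accPt_of_subset_isCompact (K := Metric.closedBall 0 R)
    h (isCompact_closedBall _ _) Set.inter_subset_right
  exact hS z (hz.mono (Filter.principal_mono.2 Set.inter_subset_left))

lemma countable_of_not_accPt {S : Set ℂ}
    (hS : ∀ z : ℂ, ¬ AccPt z (Filter.principal S)) : S.Countable := by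
  have : S = ⋃ n : ℕ, S ∩ Metric.closedBall 0 n := by
    rw [← Set.inter_iUnion, Metric.iUnion_closedBall_nat, Set.inter_univ]
  rw [this]
  exact Set.countable_iUnion fun n => (finite_inter_closedBall_of_not_accPt hS n).countable

open Polynomial in
/-- A sequence of polynomials whose partial sums eventually have the prescribed jet at each point of
`S`, and which is small on large discs. -/
lemma exists_correction_sequence {S : Set ℂ} {e : S → ℕ} (he : e.Injective) (d : ℂ → ℕ)
    (T : ℂ → ℂ[X]) :
    ∃ q : ℕ → ℂ[X],
      (∀ (w : S) (m : ℕ),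
        (X - C (w : ℂ)) ^ d w ∣ ∑ k ∈ Finset.range (e w + 1 + m), q k - T w) ∧
      ∀ (n : ℕ) (z : ℂ), (∀ a : S, e a = n → ‖z‖ < ‖(a : ℂ)‖ / 2) →
        ‖(q n).eval z‖ ≤ (1 / 2) ^ n := by
  classical
  have hstep : ∀ (n : ℕ) (P : ℂ[X]), ∃ q : ℂ[X],
      (∀ a : S, e a < n → (X - C (a : ℂ)) ^ d a ∣ q) ∧
      (∀ a : S, e a = n → (X - C (a : ℂ)) ^ d a ∣ P + q - T a) ∧
      ∀ z : ℂ, (∀ a : S, e a = n → ‖z‖ < ‖(a : ℂ)‖ / 2) → ‖q.eval z‖ ≤ (1 / 2) ^ n := by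
    intro n P
    by_cases hn : ∃ w : S, e w = n
    · obtain ⟨w, rfl⟩ := hn
      have hfin : {a : S | e a < e w}.Finite := (Set.finite_Iio (e w)).preimage he.injOn
      obtain ⟨q, h1, h2, h3⟩ := exists_small_correction
        (hfin.toFinset.image (Subtype.val)) d w (by simp) (T w - P)
        (ε := (1 / 2) ^ e w) (by positivity)
      refine ⟨q, fun a ha => h1 a (by simpa using ha), fun a ha => ?_, fun z hz => h3 z (hz w rfl)⟩
      obtain rfl := he ha
      convert h2 using 1
      ring
    · push Not at hn
      exact ⟨0, by simp, fun a ha => absurd ha (hn a), by simp⟩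
  choose F hF1 hF2 hF3 using hstep
  let P : ℕ → ℂ[X] := fun n => Nat.rec 0 (fun n p => p + F n p) n
  have hP : ∀ n, P (n + 1) = P n + F n (P n) := fun n => rfl
  let q : ℕ → ℂ[X] := fun n => F n (P n)
  have hsum : ∀ n, P n = ∑ k ∈ Finset.range n, q k := by
    intro n
    induction n with
    | zero => rfl
    | succ n ih => rw [hP, ih, Finset.sum_range_succ, ← ih]
  refine ⟨q, fun w m => ?_, fun n => hF3 n (P n)⟩
  rw [← hsum]
  induction m with
  | zero => exact hF2 _ _ w rfl
  | succ m ih =>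
    rw [← add_assoc, hP, add_sub_right_comm]
    exact dvd_add ih (hF1 _ _ w (by omega))

open Polynomial in
/-- A sequence of polynomials that is geometrically small on large discs is dominated by a summable
sequence on each disc. -/
lemma exists_summable_bound {S : Set ℂ}
    (hS : ∀ z : ℂ, ¬ AccPt z (Filter.principal S)) {e : S → ℕ} {q : ℕ → ℂ[X]}
    (hq : ∀ (n : ℕ) (z : ℂ), (∀ a : S, e a = n → ‖z‖ < ‖(a : ℂ)‖ / 2) →
      ‖(q n).eval z‖ ≤ (1 / 2) ^ n) (R : ℝ) :
    ∃ u : ℕ → ℝ, Summable u ∧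
      ∀ n, ∀ z ∈ Metric.ball (0 : ℂ) R, ‖(q n).eval z‖ ≤ u n := by
  classical
  have hB : ∀ n, ∃ B, ∀ z ∈ Metric.closedBall (0 : ℂ) R, ‖(q n).eval z‖ ≤ B := fun n =>
    (isCompact_closedBall _ _).exists_bound_of_continuousOn (q n).continuous.continuousOn
  choose B hB using hB
  let bad : Set ℕ := e '' {a : S | (a : ℂ) ∈ Metric.closedBall 0 (2 * R)}
  have hbad : bad.Finite := by
    refine Set.Finite.image e ?_
    refine ((finite_inter_closedBall_of_not_accPt hS (2 * R)).preimage
      Subtype.val_injective.injOn).subset ?_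
    exact fun a ha => ⟨a.2, ha⟩
  refine ⟨fun n => if n ∈ bad then B n else (1 / 2) ^ n, ?_, fun n z hz => ?_⟩
  · refine (summable_congr_cofinite ?_).2 summable_geometric_two
    filter_upwards [hbad.compl_mem_cofinite] with n hn
    exact if_neg hn
  · dsimp only
    split_ifs with hn
    · exact hB n z (Metric.ball_subset_closedBall hz)
    · refine hq n z fun a ha => ?_
      by_contra! h
      refine hn ⟨a, ?_, ha⟩
      simp only [Metric.mem_ball, dist_zero_right] at hz
      simp only [Set.mem_ofPred_eq, Metric.mem_closedBall, dist_zero_right]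
      linarith

open Polynomial in
/-- Entire functions can be prescribed to finite order along a closed discrete set. -/
theorem exists_entire_interpolation {S : Set ℂ}
    (hS : ∀ z : ℂ, ¬ AccPt z (Filter.principal S)) (d : ℂ → ℕ) (T : ℂ → ℂ[X]) :
    ∃ g : ℂ → ℂ, Differentiable ℂ g ∧
      ∀ w ∈ S, (fun z => g z - (T w).eval z) =O[𝓝 w] fun z => (z - w) ^ d w := by
  have : Countable S := (countable_of_not_accPt hS).to_subtype
  obtain ⟨e, he⟩ := exists_injective_nat S
  obtain ⟨q, hdvd, hsmall⟩ := exists_correction_sequence he d T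
  have hbound := exists_summable_bound hS hsmall
  refine ⟨fun z => ∑' n, (q n).eval z, fun z => ?_, fun w hw => ?_⟩
  · obtain ⟨u, hu, hq⟩ := hbound (‖z‖ + 1)
    exact (Complex.differentiableOn_tsum_of_summable_norm hu
      (fun n => (q n).differentiable.differentiableOn) Metric.isOpen_ball hq).differentiableAt
      (Metric.isOpen_ball.mem_nhds (by simp))
  · obtain ⟨u, hu, hq⟩ := hbound (‖w‖ + 2)
    have hball : ∀ z : ℂ, ‖z - w‖ ≤ 1 → z ∈ Metric.ball (0 : ℂ) (‖w‖ + 2) := by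
      intro z hz
      have := norm_le_norm_add_norm_sub' z w
      simp only [Metric.mem_ball, dist_zero_right]
      linarith
    have hu0 : ∀ n, 0 ≤ u n := fun n => (norm_nonneg _).trans (hq n w (hball w (by simp)))
    obtain ⟨D, hD⟩ : ∃ D, ∀ z ∈ Metric.closedBall w 1, ‖(T w).eval z‖ ≤ D :=
      (isCompact_closedBall _ _).exists_bound_of_continuousOn (T w).continuous.continuousOn
    refine IsBigO.of_bound (∑' n, u n + D) ?_
    filter_upwards [Metric.closedBall_mem_nhds w one_pos] with z hz
    rw [mem_closedBall_iff_norm] at hz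
    have hlim : Tendsto (fun m => ‖(∑ k ∈ Finset.range (e ⟨w, hw⟩ + 1 + m), q k - T w).eval z‖)
        atTop (𝓝 ‖∑' n, (q n).eval z - (T w).eval z‖) := by
      have h := (Summable.of_norm_bounded hu fun n => hq n z (hball z hz)).hasSum.tendsto_sum_nat
      have h2 := h.comp (tendsto_atTop_mono (f := id)
        (fun m => Nat.le_add_left m (e ⟨w, hw⟩ + 1)) tendsto_id)
      refine ((h2.sub_const _).norm).congr fun m => ?_
      simp [eval_finsetSum]
    refine le_of_tendsto' hlim fun m => ?_
    rw [norm_pow]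
    refine norm_eval_le_mul_pow_of_dvd (hdvd ⟨w, hw⟩ m) (fun y hy => ?_) hz
    rw [eval_sub, eval_finsetSum]
    refine (norm_sub_le _ _).trans (add_le_add ?_ (hD y (by simp [dist_eq_norm, hy])))
    refine (norm_sum_le _ _).trans ?_
    exact (Finset.sum_le_sum fun n _ => hq n y (hball y hy.le)).trans
      (hu.sum_le_tsum _ fun n _ => hu0 n)

open Polynomial in
/-- An analytic function agrees to any finite order with a polynomial. -/
lemma AnalyticAt.exists_polynomial_isBigO {L : ℂ → ℂ} {w : ℂ} (hL : AnalyticAt ℂ L w) (d : ℕ) :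
    ∃ T : ℂ[X], (fun z => L z - T.eval z) =O[𝓝 w] fun z => (z - w) ^ d := by
  obtain ⟨p, hp⟩ := hL
  refine ⟨∑ k ∈ Finset.range d, C (p.coeff k) * (X - C w) ^ k, ?_⟩
  have h := hp.isBigO_sub_partialSum_pow d
  have ht : Tendsto (fun z => z - w) (𝓝 w) (𝓝 0) := by
    have : ContinuousAt (fun z => z - w) w := by fun_prop
    simpa [ContinuousAt] using this
  refine ((h.comp_tendsto ht).congr_left fun z => ?_).trans ?_
  · simp [FormalMultilinearSeries.partialSum, eval_finsetSum, mul_comm]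
  · exact IsBigO.of_bound 1 (by simp)

/-- Near a point where it does not vanish, an analytic function has an analytic logarithm. -/
lemma AnalyticAt.exists_exp_eq {f : ℂ → ℂ} {w : ℂ} (hf : AnalyticAt ℂ f w) (hw : f w ≠ 0) :
    ∃ L : ℂ → ℂ, AnalyticAt ℂ L w ∧ ∀ᶠ z in 𝓝 w, Complex.exp (L z) = f z := by
  refine ⟨fun z => Complex.log (f z / f w) + Complex.log (f w), ?_, ?_⟩
  · refine AnalyticAt.add (AnalyticAt.clog (hf.div analyticAt_const hw) ?_) analyticAt_const
    simp [hw]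
  · filter_upwards [hf.continuousAt.eventually_ne hw] with z hz
    rw [Complex.exp_add, Complex.exp_log (div_ne_zero hz hw), Complex.exp_log hw,
      div_mul_cancel₀ _ hw]

/-- Mittag-Leffler interpolation by an exponential: given a closed
discrete set `S ⊆ ℂ` and, for each `w ∈ S`, a polynomial jet `J w` of degree at most
`N w` with `(J w)(w) ≠ 0`, there is an entire function `f = exp ∘ g` (with `g` entire)
matching each jet `J w` at `w` to order greater than `N w`. -/
theorem stmt16 (S : Set ℂ) (hS : ∀ z : ℂ, ¬ AccPt z (Filter.principal S))
    (N : S → ℕ) (J : S → Polynomial ℂ)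
    (hdeg : ∀ w : S, (J w).degree ≤ N w)
    (hne : ∀ w : S, (J w).eval (w : ℂ) ≠ 0) :
    ∃ f g : ℂ → ℂ,
      Differentiable ℂ f ∧ Differentiable ℂ g ∧ f = Complex.exp ∘ g ∧
      ∀ w : S,
        (fun z => f z - (J w).eval z) =o[𝓝 (w : ℂ)] fun z => (z - (w : ℂ)) ^ (N w) := by
  classical
  have hlog : ∀ w : S, ∃ L : ℂ → ℂ, AnalyticAt ℂ L w ∧
      ∀ᶠ z in 𝓝 (w : ℂ), Complex.exp (L z) = (J w).eval z := fun w =>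
    AnalyticAt.exists_exp_eq ((J w).differentiable.analyticAt _) (hne w)
  choose L hLan hL using hlog
  choose T hT using fun w : S => (hLan w).exists_polynomial_isBigO (N w + 1)
  obtain ⟨g, hg, hgT⟩ := exists_entire_interpolation hS
    (fun w => if hw : w ∈ S then N ⟨w, hw⟩ + 1 else 0)
    (fun w => if hw : w ∈ S then T ⟨w, hw⟩ else 0)
  refine ⟨Complex.exp ∘ g, g, Complex.differentiable_exp.comp hg, hg, rfl, fun w => ?_⟩
  have hgw : (fun z => g z - (T w).eval z) =O[𝓝 (w : ℂ)] fun z => (z - (w : ℂ)) ^ (N w + 1) := by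
    simpa using hgT w w.2
  have hgL : (fun z => g z - L w z) =O[𝓝 (w : ℂ)] fun z => (z - (w : ℂ)) ^ (N w + 1) :=
    (hgw.sub (hT w)).congr_left fun z => by ring
  have ht : Tendsto (fun z => z - (w : ℂ)) (𝓝 (w : ℂ)) (𝓝 0) := by
    have : ContinuousAt (fun z => z - (w : ℂ)) w := by fun_prop
    simpa [ContinuousAt] using this
  have hpow : (fun z => (z - (w : ℂ)) ^ (N w + 1)) =o[𝓝 (w : ℂ)] fun z => (z - (w : ℂ)) ^ N w :=
    (isLittleO_pow_pow (Nat.lt_succ_self (N w))).comp_tendsto ht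
  have hgLw : g w = L w w := by
    have h := hgL.eq_zero_imp.self_of_nhds (by simp)
    exact sub_eq_zero.1 h
  have hpair : Tendsto (fun z => (g z, L w z)) (𝓝 (w : ℂ)) (𝓝 (L w w, L w w)) := by
    have h := hg.continuous.continuousAt.prodMk (hLan w).continuousAt
    rwa [ContinuousAt, hgLw] at h
  have hexp : (fun z => Complex.exp (g z) - Complex.exp (L w z)) =O[𝓝 (w : ℂ)]
      fun z => g z - L w z :=
    (Complex.hasStrictDerivAt_exp (L w w)).hasStrictFDerivAt.isBigO_sub.comp_tendsto hpair
  refine ((hexp.trans hgL).trans_isLittleO hpow).congr' ?_ EventuallyEq.rfl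
  filter_upwards [hL w] with z hz
  simp [hz]
end

section
/- Let X : ℂ → M_2(ℂ) be a matrix function all of whose entries are entire, with det X(z) ≠ 0 for every z ∈ ℂ. Then the following are equivalent: (i) X is null-homotopic, i.e. there exists a continuous map H : [0,1] × ℂ → M_2(ℂ) such that for each t ∈ [0,1] all entries of H(t,·) are entire, det H(t,z) ≠ 0 for all t and z, H(0,z) = I for all z, and H(1,z) = X(z) for all z; (ii) det X admits an entire logarithm, i.e. there exists an entire h : ℂ → ℂ with det X(z) = exp(h(z)) for all z ∈ ℂ. -/
/-- A nowhere vanishing entire function has an entire logarithm. -/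
theorem Differentiable.exists_entire_log {f : ℂ → ℂ} (hf : Differentiable ℂ f)
    (h0 : ∀ z, f z ≠ 0) :
    ∃ h : ℂ → ℂ, Differentiable ℂ h ∧ ∀ z, f z = Complex.exp (h z) := by
  have hdf : Differentiable ℂ (_root_.deriv f) :=
    (hf.contDiff (n := 2)).differentiable_deriv_two
  obtain ⟨g, hg0, hg⟩ :=
    ((hdf.div hf h0).isExactOn_univ).with_val_at 0 (Complex.log (f 0))
  have hg' : ∀ z, HasDerivAt g (_root_.deriv f z / f z) z := fun z => hg z (Set.mem_univ z)
  refine ⟨g, fun z => (hg' z).differentiableAt, fun z => ?_⟩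
  have hd : ∀ w, HasDerivAt (fun w => f w * Complex.exp (-g w)) 0 w := fun w => by
    refine ((hf w).hasDerivAt.mul (hg' w).neg.cexp).congr_deriv ?_
    have := h0 w
    field_simp
    ring
  have hc := is_const_of_deriv_eq_zero (fun w => (hd w).differentiableAt)
    (fun w => (hd w).deriv) z 0
  have h1 : f 0 * Complex.exp (-g 0) = 1 := by
    rw [hg0, Complex.exp_neg, Complex.exp_log (h0 0), mul_inv_cancel₀ (h0 0)]
  rw [h1, Complex.exp_neg, ← div_eq_mul_inv, div_eq_one_iff_eq (Complex.exp_ne_zero _)] at hc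
  exact hc

/-- The complex line through `1` and an invertible matrix `A` contains a path from `1` to `A`
consisting of invertible matrices. -/
theorem Matrix.exists_path_det_one_add_smul_ne_zero {n : Type*} [Fintype n] [DecidableEq n]
    (A : Matrix n n ℂ) (hA : A.det ≠ 0) :
    ∃ γ : Path (0 : ℂ) 1, ∀ t, (1 + γ t • (A - 1)).det ≠ 0 := by
  let p : Polynomial ℂ :=
    (1 + (Polynomial.X : Polynomial ℂ) • (A - 1).map Polynomial.C).det
  have hp : ∀ w, p.eval w = (1 + w • (A - 1)).det := fun w => by
    rw [← Polynomial.coe_evalRingHom, RingHom.map_det]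
    congr 1
    ext i j
    rcases eq_or_ne i j with rfl | hij
    · simp
    · simp [hij, mul_comm w]
  have hp0 : p ≠ 0 := fun h => by simpa [h] using hp 0
  have hconn : IsPathConnected {w : ℂ | p.IsRoot w}ᶜ :=
    (Polynomial.finite_setOfPred_isRoot hp0).countable.isPathConnected_compl_of_one_lt_rank
      (by rw [Complex.rank_real_complex]; norm_num)
  obtain ⟨γ, hγ⟩ := hconn.joinedIn 0 (by simp [hp]) 1 (by simpa [hp] using hA)
  exact ⟨γ, fun t => by rw [← hp]; exact hγ t⟩

/-- an entire matrix function `X : ℂ → GL_2(ℂ)` is null-homotopic (through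
entire matrix functions with nonvanishing determinant) iff `det X` admits an entire
logarithm. -/
theorem stmt18 (X : ℂ → Matrix (Fin 2) (Fin 2) ℂ)
    (hX : ∀ i j, Differentiable ℂ fun z => X z i j)
    (hdet : ∀ z : ℂ, (X z).det ≠ 0) :
    (∃ H : ℝ × ℂ → Matrix (Fin 2) (Fin 2) ℂ,
        ContinuousOn H (Set.Icc (0 : ℝ) 1 ×ˢ (Set.univ : Set ℂ)) ∧
        (∀ t ∈ Set.Icc (0 : ℝ) 1, ∀ i j, Differentiable ℂ fun z => H (t, z) i j) ∧
        (∀ t ∈ Set.Icc (0 : ℝ) 1, ∀ z : ℂ, (H (t, z)).det ≠ 0) ∧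
        (∀ z : ℂ, H (0, z) = 1) ∧
        (∀ z : ℂ, H (1, z) = X z)) ↔
    (∃ h : ℂ → ℂ, Differentiable ℂ h ∧ ∀ z : ℂ, (X z).det = Complex.exp (h z)) := by
  -- Both sides hold unconditionally, because `ℂ` is contractible.
  refine iff_of_true ?_ ?_
  · obtain ⟨γ, hγ⟩ := (X 0).exists_path_det_one_add_smul_ne_zero (hdet 0)
    have hXc : Continuous X :=
      continuous_pi fun i => continuous_pi fun j => (hX i j).continuous
    -- First move from `1` to `X 0` along `γ`, then from `X 0` to `X` by rescaling the variable.
    refine ⟨fun q => 1 + γ.extend (2 * q.1) • (X ((max (2 * q.1 - 1) 0 : ℝ) * q.2) - 1),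
      Continuous.continuousOn ?_, fun t _ i j => ?_, fun t ht z => ?_, fun z => ?_, fun z => ?_⟩
    · have := γ.continuous_extend
      fun_prop
    · simp only [Matrix.add_apply, Matrix.smul_apply, Matrix.sub_apply, smul_eq_mul]
      exact ((((hX i j).comp (differentiable_id.const_mul _)).sub_const _).const_mul _).const_add _
    · rcases le_total (2 * t) 1 with h | h
      · have hm : max (2 * t - 1) 0 = 0 := max_eq_right (by linarith)
        have ht' : 2 * t ∈ Set.Icc (0 : ℝ) 1 := ⟨by linarith [ht.1], h⟩
        simpa [hm, γ.extend_apply ht'] using hγ ⟨2 * t, ht'⟩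
      · simpa [γ.extend_of_one_le h] using hdet _
    · simp
    · have h2 : (1 : ℝ) ≤ 2 * 1 := by norm_num
      have hm : max ((2 : ℝ) * 1 - 1) 0 = 1 := by norm_num
      simp only [γ.extend_of_one_le h2, hm]
      simp
  · refine Differentiable.exists_entire_log ?_ hdet
    simp only [Matrix.det_fin_two]
    exact ((hX 0 0).mul (hX 1 1)).sub ((hX 0 1).mul (hX 1 0))
end
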